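/- For every δ with 0 ≤ δ < √2 − 1 there exist constants C₁ > 0 and C₂ > 0, depending only on δ, with the following property. Let s ≥ 1, let Ψ be an M×N real matrix whose restricted isometry constant of order 2s satisfies δ_{2s} ≤ δ, let c ∈ ℝ^N, and let u = Ψc + ε with ‖ε‖₂ ≤ ϵ. Then every minimizer ĉ of ‖x‖₁ over {x ∈ ℝ^N : ‖Ψx − u‖₂ ≤ ϵ} satisfies ‖c − ĉ‖₂ ≤ C₁ ϵ + C₂ ‖c − c_s‖₁ / √s. -/

import Mathlib

open Matrix

/-- Any finite set with at least `s` elements contains `s` elements on which `f` is largest. -/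
lemma exists_subset_card_eq_forall_le {ι : Type*} [DecidableEq ι] (f : ι → ℝ) (s : ℕ) :
    ∀ A : Finset ι, s ≤ A.card →
      ∃ T ⊆ A, T.card = s ∧ ∀ i ∈ T, ∀ j ∈ A \ T, f j ≤ f i := by
  induction s with
  | zero => exact fun A _ => ⟨∅, by simp, by simp, by simp⟩
  | succ n ih =>
    intro A hA
    obtain ⟨m, hm, hmax⟩ := A.exists_max_image f (Finset.card_pos.mp (by omega))
    obtain ⟨T, hTA, hT, hle⟩ := ih (A.erase m) (by rw [Finset.card_erase_of_mem hm]; omega)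
    have hmT : m ∉ T := fun h => by simpa using hTA h
    refine ⟨insert m T, ?_, by rw [Finset.card_insert_of_notMem hmT, hT], ?_⟩
    · exact Finset.insert_subset hm (hTA.trans (Finset.erase_subset _ _))
    · intro i hi j hj
      simp only [Finset.mem_sdiff, Finset.mem_insert, not_or] at hi hj
      rcases hi with rfl | hi
      · exact hmax j hj.1
      · exact hle i hi j (by simp [hj.1, hj.2.1, hj.2.2])

/-- If every value of `|h|` on `T` is dominated by every value on `U`, and
`|T| ≤ |U| = s`, then the `ℓ₂` norm on `T` is at most `s^(-1/2)` times the `ℓ₁` norm on `U`. -/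
lemma sqrt_sum_sq_le_of_dominated {ι : Type*} (h : ι → ℝ) {s : ℕ} (hs : 1 ≤ s)
    {T U : Finset ι} (hT : T.card ≤ s) (hU : U.card = s)
    (hle : ∀ i ∈ U, ∀ j ∈ T, |h j| ≤ |h i|) :
    √(∑ j ∈ T, h j ^ 2) ≤ (∑ i ∈ U, |h i|) / √s := by
  have hs' : (0 : ℝ) < s := by exact_mod_cast hs
  set W := ∑ i ∈ U, |h i| with hW
  have hW0 : 0 ≤ W := Finset.sum_nonneg fun _ _ => abs_nonneg _
  have hj : ∀ j ∈ T, |h j| ≤ W / s := by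
    intro j hj
    rw [le_div_iff₀ hs', mul_comm]
    have := Finset.card_nsmul_le_sum U (fun i => |h i|) |h j| (fun i hi => hle i hi j hj)
    simpa [hU] using this
  apply Real.sqrt_le_iff.mpr
  refine ⟨by positivity, ?_⟩
  have hsum := Finset.sum_le_card_nsmul T (fun j => h j ^ 2) ((W / s) ^ 2) (fun j hjT => by
    simpa using pow_le_pow_left₀ (abs_nonneg _) (hj j hjT) 2)
  calc ∑ j ∈ T, h j ^ 2 ≤ T.card * (W / s) ^ 2 := by simpa using hsum
    _ ≤ s * (W / s) ^ 2 := by gcongr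
    _ = (W / √s) ^ 2 := by
      rw [div_pow, div_pow, Real.sq_sqrt hs'.le]; field_simp

/-- Block decomposition: after removing a suitable set `T` of at most `s` entries from `A`, any
subadditive set function that is bounded by `K` times the `ℓ₂` norm of `h` on sets of size at
most `s` is bounded on `A \ T` by `K * s^(-1/2)` times the `ℓ₁` norm of `h` on `A`. -/
lemma exists_block_bound {ι : Type*} [DecidableEq ι] (h : ι → ℝ) {s : ℕ} (hs : 1 ≤ s)
    (A : Finset ι) :
    ∃ T ⊆ A, T.card ≤ s ∧ ∀ (F : Finset ι → ℝ) (K : ℝ), 0 ≤ K → F ∅ ≤ 0 →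
      (∀ B C, Disjoint B C → F (B ∪ C) ≤ F B + F C) →
      (∀ B ⊆ A \ T, B.card ≤ s → F B ≤ K * √(∑ i ∈ B, h i ^ 2)) →
      F (A \ T) ≤ K * ((∑ i ∈ A, |h i|) / √s) := by
  induction A using Finset.strongInduction with
  | H A ih =>
  by_cases hA : A.card ≤ s
  · refine ⟨A, subset_rfl, hA, fun F K hK h0 _ _ => ?_⟩
    rw [Finset.sdiff_self]
    exact h0.trans (mul_nonneg hK
      (div_nonneg (Finset.sum_nonneg fun _ _ => abs_nonneg _) (Real.sqrt_nonneg _)))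
  obtain ⟨U, hUA, hU, hle⟩ :=
    exists_subset_card_eq_forall_le (fun i => |h i|) s A (by omega)
  have hUne : U.Nonempty := Finset.card_pos.mp (by omega)
  obtain ⟨T, hTA, hT, hF⟩ := ih (A \ U) (Finset.sdiff_ssubset hUA hUne)
  refine ⟨U, hUA, hU.le, fun F K hK h0 hadd hb => ?_⟩
  have hrest := hF F K hK h0 hadd (fun B hB => hb B (hB.trans Finset.sdiff_subset))
  have hfirst : F T ≤ K * ((∑ i ∈ U, |h i|) / √s) :=
    (hb T hTA hT).trans (mul_le_mul_of_nonneg_left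
      (sqrt_sum_sq_le_of_dominated h hs hT hU fun i hi j hj => hle i hi j (hTA hj)) hK)
  have hsplit := hadd T ((A \ U) \ T) Finset.disjoint_sdiff
  rw [Finset.union_sdiff_of_subset hTA] at hsplit
  rw [← Finset.sum_sdiff hUA, add_div, mul_add]
  linarith

/-- Approximate orthogonality: if the two-sided isometry bound with constant `δ` holds on all
combinations `t • x + y` of orthogonal vectors `x`, `y`, then the images of `x` and `y` have
inner product at most `δ ‖x‖ ‖y‖`. -/
lemma abs_dotProduct_mulVec_le {m n : Type*} [Fintype m] [Fintype n] (Ψ : Matrix m n ℝ)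
    {δ : ℝ} (hδ : 0 ≤ δ) (x y : n → ℝ) (hxy : x ⬝ᵥ y = 0)
    (hrip : ∀ t : ℝ,
      (1 - δ) * ((t • x + y) ⬝ᵥ (t • x + y)) ≤ (Ψ *ᵥ (t • x + y)) ⬝ᵥ (Ψ *ᵥ (t • x + y)) ∧
      (Ψ *ᵥ (t • x + y)) ⬝ᵥ (Ψ *ᵥ (t • x + y)) ≤ (1 + δ) * ((t • x + y) ⬝ᵥ (t • x + y))) :
    |(Ψ *ᵥ x) ⬝ᵥ (Ψ *ᵥ y)| ≤ δ * (√(x ⬝ᵥ x) * √(y ⬝ᵥ y)) := by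
  have hyx : y ⬝ᵥ x = 0 := by rw [dotProduct_comm, hxy]
  have hX : 0 ≤ x ⬝ᵥ x := Finset.sum_nonneg fun i _ => mul_self_nonneg (x i)
  have hY : 0 ≤ y ⬝ᵥ y := Finset.sum_nonneg fun i _ => mul_self_nonneg (y i)
  set P := (Ψ *ᵥ x) ⬝ᵥ (Ψ *ᵥ y) with hP
  have hP' : (Ψ *ᵥ y) ⬝ᵥ (Ψ *ᵥ x) = P := dotProduct_comm _ _
  have hquad : ∀ t : ℝ, 0 ≤ (δ * (x ⬝ᵥ x)) * (t * t) + (-2 * P) * t + δ * (y ⬝ᵥ y) := by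
    intro t
    have h₁ := (hrip t).2
    have h₂ := (hrip (-t)).1
    simp only [mulVec_add, mulVec_smul, add_dotProduct, dotProduct_add, smul_dotProduct,
      dotProduct_smul, smul_eq_mul, hxy, hyx, hP', ← hP] at h₁ h₂
    nlinarith
  have hdisc := discrim_le_zero hquad
  rw [discrim] at hdisc
  rw [← Real.sqrt_mul hX]
  apply abs_le_of_sq_le_sq
  · rw [mul_pow, Real.sq_sqrt (mul_nonneg hX hY)]
    nlinarith
  · positivity

/-- The restriction of a vector to a finite set of coordinates, extended by zero. -/
def restrictTo {n : Type*} [DecidableEq n] (T : Finset n) (h : n → ℝ) : n → ℝ :=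
  fun i => if i ∈ T then h i else 0

section restrictTo

variable {n : Type*} [DecidableEq n]

lemma restrictTo_empty (h : n → ℝ) : restrictTo ∅ h = 0 := by
  ext i; simp [restrictTo]

lemma restrictTo_univ [Fintype n] (h : n → ℝ) : restrictTo Finset.univ h = h := by
  ext i; simp [restrictTo]

lemma restrictTo_union {S T : Finset n} (hST : Disjoint S T) (h : n → ℝ) :
    restrictTo (S ∪ T) h = restrictTo S h + restrictTo T h := by
  ext i
  have : i ∈ S → i ∉ T := fun hi => Finset.disjoint_left.mp hST hi
  by_cases hS : i ∈ S <;> by_cases hT : i ∈ T <;> simp_all [restrictTo]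

lemma restrictTo_dotProduct_self [Fintype n] (T : Finset n) (h : n → ℝ) :
    restrictTo T h ⬝ᵥ restrictTo T h = ∑ i ∈ T, h i ^ 2 := by
  simp [dotProduct, restrictTo, sq]

lemma restrictTo_dotProduct_of_disjoint [Fintype n] {S T : Finset n} (hST : Disjoint S T)
    (h : n → ℝ) : restrictTo S h ⬝ᵥ restrictTo T h = 0 := by
  refine Finset.sum_eq_zero fun i _ => ?_
  have : i ∈ S → i ∉ T := fun hi => Finset.disjoint_left.mp hST hi
  by_cases hS : i ∈ S <;> simp_all [restrictTo]

end restrictTo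

/-- The two-sided restricted isometry bound of order `k` with constant `δ`. -/
def RestrictedIsometry {m n : Type*} [Fintype m] [Fintype n] (Ψ : Matrix m n ℝ) (k : ℕ)
    (δ : ℝ) : Prop :=
  ∀ (x : n → ℝ) (S : Finset n), S.card ≤ k → (∀ i ∉ S, x i = 0) →
    (1 - δ) * (x ⬝ᵥ x) ≤ (Ψ *ᵥ x) ⬝ᵥ (Ψ *ᵥ x) ∧
      (Ψ *ᵥ x) ⬝ᵥ (Ψ *ᵥ x) ≤ (1 + δ) * (x ⬝ᵥ x)

lemma RestrictedIsometry.abs_dotProduct_le {m n : Type*} [Fintype m] [Fintype n]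
    [DecidableEq n] {Ψ : Matrix m n ℝ} {s : ℕ} {δ : ℝ} (hΨ : RestrictedIsometry Ψ (2 * s) δ)
    (hδ : 0 ≤ δ) (h : n → ℝ) {S T : Finset n} (hST : Disjoint S T) (hS : S.card ≤ s)
    (hT : T.card ≤ s) :
    |(Ψ *ᵥ restrictTo S h) ⬝ᵥ (Ψ *ᵥ restrictTo T h)| ≤
      δ * (√(∑ i ∈ S, h i ^ 2) * √(∑ i ∈ T, h i ^ 2)) := by
  rw [← restrictTo_dotProduct_self, ← restrictTo_dotProduct_self]
  refine abs_dotProduct_mulVec_le Ψ hδ _ _ (restrictTo_dotProduct_of_disjoint hST h) fun t =>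
    hΨ _ (S ∪ T) ((Finset.card_union_le _ _).trans (by omega)) fun i hi => ?_
  simp only [Finset.mem_union, not_or] at hi
  simp [restrictTo, hi.1, hi.2]

lemma abs_dotProduct_le_sqrt {m : Type*} [Fintype m] (v w : m → ℝ) :
    |v ⬝ᵥ w| ≤ √(v ⬝ᵥ v) * √(w ⬝ᵥ w) := by
  have hv : 0 ≤ v ⬝ᵥ v := Finset.sum_nonneg fun i _ => mul_self_nonneg (v i)
  rw [← Real.sqrt_mul hv]
  apply Real.abs_le_sqrt
  simpa [dotProduct, sq] using Finset.sum_mul_sq_le_sq_mul_sq Finset.univ v w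

/-- Under the restricted isometry bound, the `ℓ₂` norm of `h` is controlled by the `ℓ₂` norm of
`Ψ h` and by the excess `2 e` in the cone condition on the complement of `S`. -/
lemma RestrictedIsometry.sqrt_sum_sq_le {m n : Type*} [Fintype m] [Fintype n]
    [DecidableEq n] {Ψ : Matrix m n ℝ} {s : ℕ} {δ : ℝ} (hΨ : RestrictedIsometry Ψ (2 * s) δ)
    (hs : 1 ≤ s) (hδ : 0 ≤ δ) (hκ : 0 < 1 - δ - √2 * δ) (h : n → ℝ) {S : Finset n}
    (hS : S.card ≤ s) {ρ e : ℝ} (he : 0 ≤ e) (hρ : √((Ψ *ᵥ h) ⬝ᵥ (Ψ *ᵥ h)) ≤ ρ)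
    (hcone : ∑ i ∈ Sᶜ, |h i| ≤ ∑ i ∈ S, |h i| + 2 * e) :
    √(∑ i, h i ^ 2) ≤ 2 * √(1 + δ) / (1 - δ - √2 * δ) * ρ +
      (4 * √2 * δ / (1 - δ - √2 * δ) + 2) * (e / √s) := by
  have hs' : (0 : ℝ) < √s := Real.sqrt_pos.mpr (by exact_mod_cast hs)
  have hρ0 : 0 ≤ ρ := (Real.sqrt_nonneg _).trans hρ
  obtain ⟨T, hTS, hT, hF⟩ := exists_block_bound h hs Sᶜ
  have hST : Disjoint S T := (Finset.disjoint_right.mpr fun i hi => by simpa using hTS hi)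
  set R := Sᶜ \ T with hR
  set q : Finset n → ℝ := fun B => √(∑ i ∈ B, h i ^ 2) with hq
  have hq0 : ∀ B, 0 ≤ q B := fun B => Real.sqrt_nonneg _
  have hqsq : ∀ B, q B ^ 2 = ∑ i ∈ B, h i ^ 2 := fun B =>
    Real.sq_sqrt (Finset.sum_nonneg fun _ _ => sq_nonneg _)
  have hqunion : ∀ B C, Disjoint B C → q (B ∪ C) ^ 2 = q B ^ 2 + q C ^ 2 := fun B C hBC => by
    rw [hqsq, hqsq, hqsq, Finset.sum_union hBC]
  have hqadd : ∀ B C, Disjoint B C → q (B ∪ C) ≤ q B + q C := fun B C hBC =>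
    abs_le_of_sq_le_sq' (by nlinarith [hqunion B C hBC, hq0 B, hq0 C, mul_nonneg (hq0 B) (hq0 C)])
      (add_nonneg (hq0 B) (hq0 C)) |>.2
  set a := q (S ∪ T) with ha
  have ha0 : 0 ≤ a := hq0 _
  have hasq : a ^ 2 = q S ^ 2 + q T ^ 2 := hqunion S T hST
  have hBR : Disjoint (S ∪ T) R := by
    rw [Finset.disjoint_left]; intro i hi; simp only [hR, Finset.mem_union, Finset.mem_sdiff,
      Finset.mem_compl] at hi ⊢; tauto
  have huniv : (S ∪ T) ∪ R = Finset.univ := by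
    ext i; simp only [hR, Finset.mem_union, Finset.mem_sdiff, Finset.mem_compl,
      Finset.mem_univ]; tauto
  set W := ∑ i ∈ Sᶜ, |h i| with hW
  -- the tail in `ℓ₂`
  have htail : q R ≤ W / √s := by
    simpa using hF q 1 zero_le_one (by simp [hq]) hqadd (fun B _ _ => by simp [hq])
  set z := Ψ *ᵥ restrictTo (S ∪ T) h with hz
  have hqST : q S + q T ≤ √2 * a := by
    refine abs_le_of_sq_le_sq' ?_ (by positivity) |>.2
    rw [mul_pow, Real.sq_sqrt zero_le_two, hasq]
    nlinarith [sq_nonneg (q S - q T)]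
  -- the cross term
  have hcross : |z ⬝ᵥ (Ψ *ᵥ restrictTo R h)| ≤ (√2 * δ * a) * (W / √s) := by
    refine hF (fun B => |z ⬝ᵥ (Ψ *ᵥ restrictTo B h)|) _ (by positivity)
      (by simp [restrictTo_empty]) (fun B C hBC => ?_) (fun B hB hBs => ?_)
    · simp only [restrictTo_union hBC, mulVec_add, dotProduct_add]
      exact abs_add_le _ _
    · have hBR' := Finset.disjoint_of_subset_right hB hBR
      rw [Finset.disjoint_union_left] at hBR'
      have h₁ := hΨ.abs_dotProduct_le hδ h hBR'.1 hS hBs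
      have h₂ := hΨ.abs_dotProduct_le hδ h hBR'.2 hT hBs
      simp only [hz, restrictTo_union hST, mulVec_add, add_dotProduct]
      calc _ ≤ δ * (q S * q B) + δ * (q T * q B) := (abs_add_le _ _).trans (add_le_add h₁ h₂)
        _ = δ * q B * (q S + q T) := by ring
        _ ≤ δ * q B * (√2 * a) :=
          mul_le_mul_of_nonneg_left hqST (mul_nonneg hδ (hq0 B))
        _ = _ := by simp only [hq]; ring
  have hrip := hΨ (restrictTo (S ∪ T) h) (S ∪ T) ((Finset.card_union_le _ _).trans (by omega))
    (fun i hi => by simp [restrictTo, hi])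
  rw [restrictTo_dotProduct_self, ← hqsq, ← hz, ← ha] at hrip
  have hzle : √(z ⬝ᵥ z) ≤ √(1 + δ) * a := by
    rw [← Real.sqrt_sq ha0, ← Real.sqrt_mul (by positivity)]
    exact Real.sqrt_le_sqrt hrip.2
  have hinner : z ⬝ᵥ (Ψ *ᵥ h) ≤ √(1 + δ) * a * ρ :=
    (le_abs_self _).trans <| (abs_dotProduct_le_sqrt _ _).trans <|
      mul_le_mul hzle hρ (Real.sqrt_nonneg _) (by positivity)
  have hsplit : z ⬝ᵥ (Ψ *ᵥ h) = z ⬝ᵥ z + z ⬝ᵥ (Ψ *ᵥ restrictTo R h) := by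
    rw [hz, ← dotProduct_add, ← mulVec_add, ← restrictTo_union hBR, huniv, restrictTo_univ]
  have hWle : W / √s ≤ a + 2 * (e / √s) := by
    have h₁ : ∑ i ∈ S, |h i| ≤ √s * q S := by
      rw [hq, ← Real.sqrt_mul (by positivity)]
      apply Real.le_sqrt_of_sq_le
      have := sq_sum_le_card_mul_sum_sq (s := S) (f := fun i => |h i|)
      simp only [sq_abs] at this
      exact this.trans (mul_le_mul_of_nonneg_right (by exact_mod_cast hS)
        (Finset.sum_nonneg fun _ _ => sq_nonneg _))
    have h₂ : q S ≤ a := abs_le_of_sq_le_sq' (by nlinarith [sq_nonneg (q T)]) ha0 |>.2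
    rw [div_le_iff₀ hs', add_mul, mul_assoc, div_mul_cancel₀ _ hs'.ne']
    nlinarith
  set κ := 1 - δ - √2 * δ with hκdef
  set w := e / √s with hw
  have hw0 : 0 ≤ w := by positivity
  have hmain : κ * a ≤ √(1 + δ) * ρ + 2 * √2 * δ * w := by
    rcases ha0.eq_or_lt with h0 | hpos
    · rw [← h0]; simp only [mul_zero]; positivity
    · refine le_of_mul_le_mul_right ?_ hpos
      have h₁ := (abs_le.mp hcross).1
      have h₂ : √2 * δ * a * (W / √s) ≤ √2 * δ * a * (a + 2 * w) := by gcongr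
      rw [hκdef]
      nlinarith [hrip.1]
  have ha' : a ≤ (√(1 + δ) * ρ + 2 * √2 * δ * w) / κ := by
    rw [le_div_iff₀ hκ]; linarith
  have hfinal : q Finset.univ ≤ a + q R := huniv ▸ hqadd _ _ hBR
  calc q Finset.univ ≤ 2 * a + 2 * w := by linarith
    _ ≤ 2 * ((√(1 + δ) * ρ + 2 * √2 * δ * w) / κ) + 2 * w := by linarith
    _ = _ := by ring

/-- The cone condition satisfied by the error of an `ℓ₁` minimizer. -/
lemma sum_compl_abs_sub_le {n : Type*} [Fintype n] [DecidableEq n] (c d : n → ℝ)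
    (hd : ∑ i, |d i| ≤ ∑ i, |c i|) (S : Finset n) :
    ∑ i ∈ Sᶜ, |c i - d i| ≤ ∑ i ∈ S, |c i - d i| + 2 * ∑ i ∈ Sᶜ, |c i| := by
  have h₁ : ∑ i ∈ S, (|c i| - |c i - d i|) ≤ ∑ i ∈ S, |d i| :=
    Finset.sum_le_sum fun i _ => by linarith [abs_sub_abs_le_abs_sub (c i) (d i)]
  have h₂ : ∑ i ∈ Sᶜ, (|c i - d i| - |c i|) ≤ ∑ i ∈ Sᶜ, |d i| :=
    Finset.sum_le_sum fun i _ => by linarith [abs_sub (c i) (d i)]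
  rw [Finset.sum_sub_distrib] at h₁ h₂
  rw [← Finset.sum_add_sum_compl S, ← Finset.sum_add_sum_compl S (fun i => |c i|)] at hd
  linarith

/-- For every `0 ≤ δ < √2 − 1` there are constants `C₁, C₂ > 0`,
depending only on `δ`, such that: if `s ≥ 1`, `Ψ` is an `M × N` real matrix whose
restricted isometry constant of order `2s` satisfies `δ_{2s} ≤ δ` (i.e. the two-sided
RIP inequality with constant `δ` holds for all `2s`-sparse vectors), `c ∈ ℝ^N`, and
`u = Ψc + ε` with `‖ε‖₂ ≤ ϵ`, then every minimizer `chat` of the `ℓ₁` norm over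
`{x : ‖Ψx − u‖₂ ≤ ϵ}` satisfies `‖c − chat‖₂ ≤ C₁ ϵ + C₂ ‖c − c_s‖₁ / √s`, where `c_s`
is the best `s`-sparse approximation of `c` in the `ℓ₁` norm. -/
theorem stmt2 (δ : ℝ) (hδ0 : 0 ≤ δ) (hδ : δ < Real.sqrt 2 - 1) :
    ∃ C₁ > (0 : ℝ), ∃ C₂ > (0 : ℝ),
      ∀ (M N s : ℕ), 1 ≤ s →
      ∀ Ψ : Matrix (Fin M) (Fin N) ℝ,
        (∀ x : Fin N → ℝ, (Finset.univ.filter fun i => x i ≠ 0).card ≤ 2 * s →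
          (1 - δ) * (∑ i, x i ^ 2) ≤ (∑ q, (Ψ.mulVec x) q ^ 2) ∧
          (∑ q, (Ψ.mulVec x) q ^ 2) ≤ (1 + δ) * (∑ i, x i ^ 2)) →
      ∀ (c : Fin N → ℝ) (ε : Fin M → ℝ) (ϵ : ℝ),
        Real.sqrt (∑ q, ε q ^ 2) ≤ ϵ →
      ∀ u : Fin M → ℝ, u = Ψ.mulVec c + ε →
      ∀ cs : Fin N → ℝ,
        (Finset.univ.filter fun i => cs i ≠ 0).card ≤ s →
        (∀ z : Fin N → ℝ, (Finset.univ.filter fun i => z i ≠ 0).card ≤ s →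
          (∑ i, |c i - cs i|) ≤ ∑ i, |c i - z i|) →
      ∀ chat : Fin N → ℝ,
        Real.sqrt (∑ q, (Ψ.mulVec chat q - u q) ^ 2) ≤ ϵ →
        (∀ x : Fin N → ℝ, Real.sqrt (∑ q, (Ψ.mulVec x q - u q) ^ 2) ≤ ϵ →
          (∑ i, |chat i|) ≤ ∑ i, |x i|) →
      Real.sqrt (∑ i, (c i - chat i) ^ 2) ≤
        C₁ * ϵ + C₂ * (∑ i, |c i - cs i|) / Real.sqrt s := by
  have h2 : (√2 : ℝ) ^ 2 = 2 := Real.sq_sqrt zero_le_two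
  have hκ : 0 < 1 - δ - √2 * δ := by nlinarith [Real.sqrt_nonneg 2]
  refine ⟨4 * √(1 + δ) / (1 - δ - √2 * δ), by positivity,
    4 * √2 * δ / (1 - δ - √2 * δ) + 2, by positivity, ?_⟩
  intro M N s hs Ψ hΨ c ε ϵ hε u hu cs hcs _ chat hfeas hmin
  have hϵ : 0 ≤ ϵ := (Real.sqrt_nonneg _).trans hε
  have hrip : RestrictedIsometry Ψ (2 * s) δ := by
    intro x S hS hx
    have hcard : (Finset.univ.filter fun i => x i ≠ 0).card ≤ 2 * s :=
      (Finset.card_le_card fun i hi => by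
        by_contra hiS
        exact (Finset.mem_filter.mp hi).2 (hx i hiS)).trans hS
    simpa only [dotProduct, ← sq] using hΨ x hcard
  have hl1 : ∑ i, |chat i| ≤ ∑ i, |c i| := hmin c (by simpa [hu] using hε)
  set S := Finset.univ.filter fun i => cs i ≠ 0 with hSdef
  have hbest : ∑ i ∈ Sᶜ, |c i| ≤ ∑ i, |c i - cs i| := by
    calc ∑ i ∈ Sᶜ, |c i| = ∑ i ∈ Sᶜ, |c i - cs i| :=
          Finset.sum_congr rfl fun i hi => by
            have : cs i = 0 := by simpa [hSdef] using hi
            rw [this, sub_zero]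
      _ ≤ _ := Finset.sum_le_sum_of_subset_of_nonneg (Finset.subset_univ _)
          fun _ _ _ => abs_nonneg _
  have hcone := sum_compl_abs_sub_le c chat hl1 S
  have htube : √((Ψ *ᵥ (c - chat)) ⬝ᵥ (Ψ *ᵥ (c - chat))) ≤ 2 * ϵ := by
    rw [Real.sqrt_le_iff] at hε hfeas
    refine Real.sqrt_le_iff.mpr ⟨by positivity, ?_⟩
    have hle : (Ψ *ᵥ (c - chat)) ⬝ᵥ (Ψ *ᵥ (c - chat)) ≤
        ∑ q, (2 * ε q ^ 2 + 2 * ((Ψ *ᵥ chat) q - u q) ^ 2) := by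
      refine Finset.sum_le_sum fun q _ => ?_
      simp only [hu, mulVec_sub, Pi.sub_apply, Pi.add_apply]
      nlinarith [sq_nonneg (ε q - ((Ψ *ᵥ chat) q - ((Ψ *ᵥ c) q + ε q)))]
    rw [Finset.sum_add_distrib, ← Finset.mul_sum, ← Finset.mul_sum] at hle
    nlinarith [hε.2, hfeas.2]
  have hmain := hrip.sqrt_sum_sq_le hs hδ0 hκ (c - chat) hcs
    (e := ∑ i, |c i - cs i|) (Finset.sum_nonneg fun _ _ => abs_nonneg _) htube
    (by simp only [Pi.sub_apply]; linarith)
  simp only [Pi.sub_apply] at hmain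
  refine hmain.trans (le_of_eq ?_)
  ring
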